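/- arXiv:1701.00635 — 5 statements merged into one kernel-verified Lean document; each statement's English description precedes it below -/
import Mathlib

section
/- Let α be a linearly ordered type, A₁, A₂ nonempty multisets over α, and (A₁', A₂') a valid block comparison result for (A₁, A₂). If C is a multiset with A₁ ⪯ C or A₂ ⪯ C, then A₁' ⪯ C. (Block analogue of the direct relation a₁' ≤ aᵢ² of the elementary comparison element.) -/
/-- Block order: every element of `A` is `≤` every element of `B`. -/
def BlockLE {α : Type*} [LinearOrder α] (A B : Multiset α) : Prop :=
  ∀ a ∈ A, ∀ b ∈ B, a ≤ b

/-- Minimum of a multiset, valued in `WithTop α` (equals `↑(min A)` for nonempty `A`). -/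
noncomputable def mMin {α : Type*} [LinearOrder α] (A : Multiset α) : WithTop α :=
  (A.map (fun a => (a : WithTop α))).inf

/-- Maximum of a multiset, valued in `WithBot α` (equals `↑(max A)` for nonempty `A`). -/
noncomputable def mMax {α : Type*} [LinearOrder α] (A : Multiset α) : WithBot α :=
  (A.map (fun a => (a : WithBot α))).sup

/-- `(A₁', A₂')` is a valid block comparison result for the pair `(A₁, A₂)`:
(i) the union is preserved, (ii) `A₁' ⪯ A₂'`, and (iii) with
`lb = max (min A₁) (min A₂)` and `ub = min (max A₁) (max A₂)`, every copy of an
element `< lb` lies in `A₁'` and every copy of an element `> ub` lies in `A₂'`. -/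
noncomputable def ValidBlockComp {α : Type*} [LinearOrder α]
    (A₁ A₂ A₁' A₂' : Multiset α) : Prop :=
  A₁' + A₂' = A₁ + A₂ ∧
  BlockLE A₁' A₂' ∧
  (A₁ + A₂).filter (fun x => (x : WithTop α) < max (mMin A₁) (mMin A₂)) ≤ A₁' ∧
  (A₁ + A₂).filter (fun x => min (mMax A₁) (mMax A₂) < (x : WithBot α)) ≤ A₂'

theorem mMax_le_coe {α : Type*} [LinearOrder α] {A : Multiset α} {c : α}
    (h : ∀ a ∈ A, a ≤ c) : mMax A ≤ (c : WithBot α) := by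
  refine Multiset.sup_le.2 fun b hb => ?_
  simp only [Multiset.bind_def, Multiset.pure_def, Multiset.bind_singleton, Multiset.map_id',
    Multiset.mem_map] at hb
  obtain ⟨a, ha, rfl⟩ := hb
  exact WithBot.coe_le_coe.2 (h a ha)

/-- Elements of the lower output block do not exceed `min (max A₁) (max A₂)`. -/
theorem ValidBlockComp.coe_le_min_mMax {α : Type*} [LinearOrder α]
    {A₁ A₂ A₁' A₂' : Multiset α} (hv : ValidBlockComp A₁ A₂ A₁' A₂') {x : α}
    (hx : x ∈ A₁') : (x : WithBot α) ≤ min (mMax A₁) (mMax A₂) := by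
  classical
  obtain ⟨hsum, -, -, hub⟩ := hv
  simp only [Multiset.bind_def, Multiset.pure_def, Multiset.bind_singleton] at hub
  by_contra! hlt
  have hcount := Multiset.count_le_of_le (x : WithBot α) hub
  rw [Multiset.count_filter_of_pos hlt, ← hsum,
    Multiset.count_map_eq_count' _ _ WithBot.coe_injective,
    Multiset.count_map_eq_count' _ _ WithBot.coe_injective, Multiset.count_add] at hcount
  have hpos := Multiset.count_pos.2 hx
  omega

/-- block analogue of the direct relation `a₁' ≤ aᵢ²`. -/
theorem blockComp_fst_le_of_le {α : Type*} [LinearOrder α]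
    (A₁ A₂ A₁' A₂' C : Multiset α) (h₁ : A₁ ≠ 0) (h₂ : A₂ ≠ 0)
    (hv : ValidBlockComp A₁ A₂ A₁' A₂')
    (hC : BlockLE A₁ C ∨ BlockLE A₂ C) :
    BlockLE A₁' C := by
  intro x hx c hc
  have hle := le_min_iff.1 (hv.coe_le_min_mMax hx)
  rcases hC with h | h
  · exact WithBot.coe_le_coe.1 (hle.1.trans (mMax_le_coe fun a ha => h a ha c hc))
  · exact WithBot.coe_le_coe.1 (hle.2.trans (mMax_le_coe fun a ha => h a ha c hc))
end

section
/- Let α be a linearly ordered type, A₁, A₂ nonempty multisets over α, and (A₁', A₂') a valid block comparison result for (A₁, A₂). If C is a multiset with C ⪯ A₁ or C ⪯ A₂, then C ⪯ A₂'. (Block analogue of the direct relation aᵢ¹ ≤ a₂' of the elementary comparison element.) -/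
theorem BlockLE.coe_le_mMin {α : Type*} [LinearOrder α] {A C : Multiset α}
    (h : BlockLE C A) {c : α} (hc : c ∈ C) : (c : WithTop α) ≤ mMin A := by
  rw [mMin, Multiset.le_inf]
  intro b hb
  simp only [Multiset.bind_def, Multiset.pure_def, Multiset.bind_singleton, Multiset.map_id',
    Multiset.mem_map] at hb
  obtain ⟨a, ha, rfl⟩ := hb
  exact WithTop.coe_le_coe.2 (h c hc a ha)

/-- If all copies in `A + B` of elements satisfying `p` lie in `A`, no element of `B`
satisfies `p`. -/
theorem Multiset.not_of_mem_of_filter_add_le {α : Type*} {A B : Multiset α} {p : α → Prop}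
    [DecidablePred p] (h : (A + B).filter p ≤ A) {b : α} (hb : b ∈ B) : ¬ p b := by
  have hA : (A + B).filter p ≤ A.filter p := by
    simpa using Multiset.filter_le_filter p h
  have hB : B.filter p = 0 := by
    have := Multiset.card_le_card hA
    rw [Multiset.filter_add, Multiset.card_add] at this
    exact Multiset.card_eq_zero.1 (by omega)
  exact Multiset.filter_eq_nil.1 hB b hb

/-- block analogue of the direct relation `aᵢ¹ ≤ a₂'`. -/
theorem le_blockComp_snd_of_le {α : Type*} [LinearOrder α]
    (A₁ A₂ A₁' A₂' C : Multiset α) (h₁ : A₁ ≠ 0) (h₂ : A₂ ≠ 0)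
    (hv : ValidBlockComp A₁ A₂ A₁' A₂')
    (hC : BlockLE C A₁ ∨ BlockLE C A₂) :
    BlockLE C A₂' := by
  obtain ⟨hadd, -, hlb, -⟩ := hv
  simp only [← hadd, Multiset.bind_def, Multiset.pure_def, Multiset.bind_singleton,
    Multiset.map_add] at hlb
  intro c hc y hy
  have hy_lb := not_lt.1 (Multiset.not_of_mem_of_filter_add_le hlb (Multiset.mem_map_of_mem _ hy))
  have hc_lb : (c : WithTop α) ≤ max (mMin A₁) (mMin A₂) :=
    le_max_iff.2 (hC.imp (fun h => h.coe_le_mMin hc) fun h => h.coe_le_mMin hc)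
  exact WithTop.coe_le_coe.1 (hc_lb.trans hy_lb)
end

section
/- Let α be a linearly ordered type, A₁, A₂ nonempty multisets over α with A₁ ⪯ A₂, and let (A₁', A₂') be a valid block comparison result for (A₁, A₂). Then for any multisets C and D: if C ⪯ A₁ then C ⪯ A₁', and if A₂ ⪯ D then A₂' ⪯ D. (Block analogue of direct relation (6): when the inputs are already ordered, lower and upper bounds of the respective inputs remain bounds of the respective outputs.) -/
/-- when the inputs are already ordered, lower and upper bounds
of the respective inputs remain bounds of the respective outputs. -/
theorem blockComp_bounds_of_ordered_inputs {α : Type*} [LinearOrder α]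
    (A₁ A₂ A₁' A₂' : Multiset α) (h₁ : A₁ ≠ 0) (h₂ : A₂ ≠ 0)
    (hord : BlockLE A₁ A₂)
    (hv : ValidBlockComp A₁ A₂ A₁' A₂') :
    ∀ C D : Multiset α,
      (BlockLE C A₁ → BlockLE C A₁') ∧ (BlockLE A₂ D → BlockLE A₂' D) := by
  have hmem : ∀ x, x ∈ A₁' ∨ x ∈ A₂' → x ∈ A₁ ∨ x ∈ A₂ := fun x hx => by
    rwa [← Multiset.mem_add, hv.1, Multiset.mem_add] at hx
  obtain ⟨a, ha⟩ := Multiset.exists_mem_of_ne_zero h₁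
  obtain ⟨b, hb⟩ := Multiset.exists_mem_of_ne_zero h₂
  refine fun C D => ⟨fun hC c hc x hx => ?_, fun hD x hx d hd => ?_⟩
  · rcases hmem x (.inl hx) with h | h
    · exact hC c hc x h
    · exact (hC c hc a ha).trans (hord a ha x h)
  · rcases hmem x (.inr hx) with h | h
    · exact (hord x h b hb).trans (hD b hb d hd)
    · exact hD x h d hd
end

section
/- Let α be a linearly ordered type, A₁, A₂ nonempty multisets over α, and (A₁', A₂') a valid block comparison result for (A₁, A₂). Then every element of A₁' is ≤ ub = min(max A₁, max A₂) and every element of A₂' is ≥ lb = max(min A₁, min A₂). Moreover, if A₁' and A₂' are nonempty, then min A₁' = min(min A₁, min A₂) and max A₂' = max(max A₁, max A₂). -/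
theorem Multiset.notMem_left_of_filter_map_le_right {α β : Type*} {A B C : Multiset α}
    {f : α → β} {p : β → Prop} [DecidablePred p] (hf : f.Injective) (hU : A + B = C)
    (hB : (C.map f).filter p ≤ B.map f) {x : α} (hx : p (f x)) : x ∉ A := by
  classical
  intro hA
  have hc := Multiset.count_le_of_le (f x) hB
  rw [Multiset.count_filter_of_pos hx, ← hU, Multiset.count_map_eq_count' f _ hf,
    Multiset.count_map_eq_count' f _ hf, Multiset.count_add] at hc
  have := Multiset.count_pos.mpr hA
  omega

theorem mMin_eq_inf_map {α : Type*} [LinearOrder α] (A : Multiset α) :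
    mMin A = (A.map WithTop.some).inf := by
  simp [mMin]

theorem mMax_eq_sup_map {α : Type*} [LinearOrder α] (A : Multiset α) :
    mMax A = (A.map WithBot.some).sup := by
  simp [mMax]

theorem mMin_add {α : Type*} [LinearOrder α] (A B : Multiset α) :
    mMin (A + B) = min (mMin A) (mMin B) := by
  simp [mMin_eq_inf_map]

theorem mMax_add {α : Type*} [LinearOrder α] (A B : Multiset α) :
    mMax (A + B) = max (mMax A) (mMax B) := by
  simp [mMax_eq_sup_map]

theorem BlockLE.mMin_le {α : Type*} [LinearOrder α] {A B : Multiset α}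
    (h : BlockLE A B) (hA : A ≠ 0) : mMin A ≤ mMin B := by
  rw [mMin_eq_inf_map, mMin_eq_inf_map]
  obtain ⟨a, ha⟩ := Multiset.exists_mem_of_ne_zero hA
  refine Multiset.le_inf.mpr fun y hy => ?_
  obtain ⟨b, hb, rfl⟩ := Multiset.mem_map.mp hy
  exact (Multiset.inf_le (Multiset.mem_map_of_mem _ ha)).trans
    (WithTop.coe_le_coe.mpr (h a ha b hb))

theorem BlockLE.mMax_le {α : Type*} [LinearOrder α] {A B : Multiset α}
    (h : BlockLE A B) (hB : B ≠ 0) : mMax A ≤ mMax B := by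
  rw [mMax_eq_sup_map, mMax_eq_sup_map]
  obtain ⟨b, hb⟩ := Multiset.exists_mem_of_ne_zero hB
  refine Multiset.sup_le.mpr fun y hy => ?_
  obtain ⟨a, ha, rfl⟩ := Multiset.mem_map.mp hy
  exact (WithBot.coe_le_coe.mpr (h a ha b hb)).trans
    (Multiset.le_sup (Multiset.mem_map_of_mem _ hb))

/-- elements of `A₁'` are `≤ ub`, elements of `A₂'` are `≥ lb`,
and (for nonempty outputs) `min A₁' = min (min A₁) (min A₂)` and
`max A₂' = max (max A₁) (max A₂)`. -/
theorem blockComp_extrema {α : Type*} [LinearOrder α]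
    (A₁ A₂ A₁' A₂' : Multiset α) (h₁ : A₁ ≠ 0) (h₂ : A₂ ≠ 0)
    (hv : ValidBlockComp A₁ A₂ A₁' A₂') :
    (∀ x ∈ A₁', (x : WithBot α) ≤ min (mMax A₁) (mMax A₂)) ∧
    (∀ x ∈ A₂', max (mMin A₁) (mMin A₂) ≤ (x : WithTop α)) ∧
    (A₁' ≠ 0 → A₂' ≠ 0 →
      mMin A₁' = min (mMin A₁) (mMin A₂) ∧
      mMax A₂' = max (mMax A₁) (mMax A₂)) := by
  obtain ⟨hU, hle, hlo, hhi⟩ := hv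
  simp only [Multiset.bind_def, Multiset.pure_def, Multiset.bind_singleton] at hlo hhi
  refine ⟨fun x hx => ?_, fun x hx => ?_, fun hA hB => ⟨?_, ?_⟩⟩
  · by_contra! hlt
    exact Multiset.notMem_left_of_filter_map_le_right WithBot.coe_injective hU hhi hlt hx
  · by_contra! hlt
    exact Multiset.notMem_left_of_filter_map_le_right WithTop.coe_injective
      ((add_comm _ _).trans hU) hlo hlt hx
  · rw [← mMin_add, ← hU, mMin_add, min_eq_left (hle.mMin_le hA)]
  · rw [← mMax_add, ← hU, mMax_add, max_eq_right (hle.mMax_le hB)]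
end

section
/- Let α be a linearly ordered type and let A₁, A₂ be nonempty multisets over α that are ordered or overlapping, oriented so that min A₂ ≤ min A₁ and max A₂ ≤ max A₁. If (A₁', A₂') is a valid block comparison result for (A₁, A₂) with A₁' and A₂' nonempty, then A₁' is a direct descendant of A₂ and A₂' is a direct descendant of A₁; that is, min A₂ ≤ min A₁', max A₁' ≤ max A₂, min A₁ ≤ min A₂', and max A₂' ≤ max A₁. -/
theorem le_mMin_iff {α : Type*} [LinearOrder α] {A : Multiset α} {c : WithTop α} :
    c ≤ mMin A ↔ ∀ x ∈ A, c ≤ x := by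
  simp [mMin, Multiset.le_inf]

theorem mMax_le_iff {α : Type*} [LinearOrder α] {A : Multiset α} {c : WithBot α} :
    mMax A ≤ c ↔ ∀ x ∈ A, (x : WithBot α) ≤ c := by
  simp [mMax, Multiset.sup_le]

/-- If one summand contains every copy of the elements satisfying `p`, the other has none. -/
theorem Multiset.not_of_filter_add_le {α : Type*} {p : α → Prop} [DecidablePred p]
    {A B : Multiset α} (h : (A + B).filter p ≤ A) {x : α} (hx : x ∈ B) : ¬ p x := by
  classical
  intro hp
  have hc := Multiset.le_iff_count.1 h x
  rw [Multiset.count_filter_of_pos hp, Multiset.count_add] at hc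
  have := Multiset.count_pos.2 hx
  omega

/-- for ordered or overlapping blocks (oriented with
`min A₂ ≤ min A₁` and `max A₂ ≤ max A₁`), `A₁'` is a direct descendant of `A₂`
and `A₂'` is a direct descendant of `A₁`. -/
theorem blockComp_direct_descendants {α : Type*} [LinearOrder α]
    (A₁ A₂ A₁' A₂' : Multiset α) (h₁ : A₁ ≠ 0) (h₂ : A₂ ≠ 0)
    (hmin : mMin A₂ ≤ mMin A₁) (hmax : mMax A₂ ≤ mMax A₁)
    (hv : ValidBlockComp A₁ A₂ A₁' A₂')
    (h₁' : A₁' ≠ 0) (h₂' : A₂' ≠ 0) :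
    mMin A₂ ≤ mMin A₁' ∧ mMax A₁' ≤ mMax A₂ ∧
    mMin A₁ ≤ mMin A₂' ∧ mMax A₂' ≤ mMax A₁ := by
  obtain ⟨hsum, -, hlo, hhi⟩ := hv
  have hmem : ∀ x, x ∈ A₁' ∨ x ∈ A₂' → x ∈ A₁ ∨ x ∈ A₂ := fun x hx => by
    rwa [← Multiset.mem_add, ← hsum, Multiset.mem_add]
  refine ⟨le_mMin_iff.2 fun x hx => ?_, mMax_le_iff.2 fun x hx => ?_,
    le_mMin_iff.2 fun x hx => ?_, mMax_le_iff.2 fun x hx => ?_⟩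
  · rcases hmem x (Or.inl hx) with h | h
    · exact hmin.trans (le_mMin_iff.1 le_rfl x h)
    · exact le_mMin_iff.1 le_rfl x h
  · rw [← hsum, add_comm] at hhi
    simp only [Multiset.pure_def, Multiset.bind_def, Multiset.bind_singleton,
      Multiset.map_add] at hhi
    simpa [min_eq_right hmax] using
      Multiset.not_of_filter_add_le hhi (Multiset.mem_map_of_mem _ hx)
  · rw [← hsum] at hlo
    simp only [Multiset.pure_def, Multiset.bind_def, Multiset.bind_singleton,
      Multiset.map_add] at hlo
    simpa [max_eq_left hmin] using
      Multiset.not_of_filter_add_le hlo (Multiset.mem_map_of_mem _ hx)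
  · rcases hmem x (Or.inr hx) with h | h
    · exact mMax_le_iff.1 le_rfl x h
    · exact (mMax_le_iff.1 le_rfl x h).trans hmax
end
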